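/- Let A ∈ ℝ^{m×n} have full column rank with least singular value σ = σ_min(A) > 0, let D ∈ ℝ^{m×n} have operator 2-norm δ = ‖D‖, and let λ > 0. Define the block matrices M = [0_{n×n}; A] and M̂ = [λ I_n; A + D] in ℝ^{(n+m)×n}, and their Moore–Penrose pseudoinverses B = (AᵀA)^{−1} Mᵀ and B̂ = (λ² I_n + (A+D)ᵀ(A+D))^{−1} M̂ᵀ (both well defined since AᵀA and λ² I_n + (A+D)ᵀ(A+D) are invertible). Then S = B − B̂ satisfies ‖S‖ ≤ 2 (λ + δ) / ( σ (λ + (σ − δ)⁺) ), where (x)⁺ = max(0, x) and ‖·‖ is the operator 2-norm. -/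

import Mathlib

open Real Finset Matrix

/-- Euclidean norm of a finite real vector. -/
noncomputable def evnorm {ι : Type*} [Fintype ι] (v : ι → ℝ) : ℝ :=
  Real.sqrt (∑ i, v i ^ 2)

/-- Operator 2-norm of a real matrix. -/
noncomputable def opNorm {ι κ : Type*} [Fintype ι] [Fintype κ] (A : Matrix ι κ ℝ) : ℝ :=
  sSup {r | ∃ x : κ → ℝ, evnorm x = 1 ∧ r = evnorm (A.mulVec x)}

/-- Least singular value of a real matrix. -/
noncomputable def sigmaMin {ι κ : Type*} [Fintype ι] [Fintype κ] (A : Matrix ι κ ℝ) : ℝ :=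
  sInf {r | ∃ x : κ → ℝ, evnorm x = 1 ∧ r = evnorm (A.mulVec x)}

lemma evnorm_eq_norm {ι : Type*} [Fintype ι] (v : ι → ℝ) : evnorm v = ‖WithLp.toLp 2 v‖ := by
  simp [evnorm, EuclideanSpace.norm_eq]

lemma evnorm_nonneg {ι : Type*} [Fintype ι] (v : ι → ℝ) : 0 ≤ evnorm v := Real.sqrt_nonneg _

lemma evnorm_sq {ι : Type*} [Fintype ι] (v : ι → ℝ) : evnorm v ^ 2 = v ⬝ᵥ v := by
  rw [evnorm, Real.sq_sqrt (Finset.sum_nonneg fun i _ => sq_nonneg _)]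
  simp [dotProduct, sq]

lemma evnorm_smul {ι : Type*} [Fintype ι] (c : ℝ) (v : ι → ℝ) :
    evnorm (c • v) = |c| * evnorm v := by
  rw [evnorm_eq_norm, evnorm_eq_norm, WithLp.toLp_smul, norm_smul, Real.norm_eq_abs]

lemma evnorm_sub_rev {ι : Type*} [Fintype ι] (v w : ι → ℝ) : evnorm (v - w) = evnorm (w - v) := by
  rw [evnorm_eq_norm, evnorm_eq_norm, WithLp.toLp_sub, WithLp.toLp_sub, norm_sub_rev]

lemma evnorm_sub_le_evnorm_add {ι : Type*} [Fintype ι] (v w : ι → ℝ) :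
    evnorm v - evnorm w ≤ evnorm (v + w) := by
  rw [evnorm_eq_norm, evnorm_eq_norm, evnorm_eq_norm, WithLp.toLp_add]
  exact norm_sub_le_norm_add _ _

lemma evnorm_eq_zero {ι : Type*} [Fintype ι] {v : ι → ℝ} : evnorm v = 0 ↔ v = 0 := by
  rw [evnorm_eq_norm, norm_eq_zero, WithLp.toLp_eq_zero]

lemma dotProduct_le_evnorm_mul_evnorm {ι : Type*} [Fintype ι] (v w : ι → ℝ) :
    v ⬝ᵥ w ≤ evnorm v * evnorm w := by
  have h := real_inner_le_norm (WithLp.toLp 2 v) (WithLp.toLp 2 w)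
  rw [evnorm_eq_norm, evnorm_eq_norm]
  simpa [PiLp.inner_apply, dotProduct, mul_comm] using h

lemma evnorm_mulVec_fromRows_sq {ι₁ ι₂ κ : Type*} [Fintype ι₁] [Fintype ι₂] [Fintype κ]
    (P : Matrix ι₁ κ ℝ) (Q : Matrix ι₂ κ ℝ) (x : κ → ℝ) :
    evnorm (Matrix.fromRows P Q *ᵥ x) ^ 2 = evnorm (P *ᵥ x) ^ 2 + evnorm (Q *ᵥ x) ^ 2 := by
  simp [evnorm_sq, Matrix.fromRows_mulVec, dotProduct, Fintype.sum_sum_type]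

lemma opNorm_nonneg {ι κ : Type*} [Fintype ι] [Fintype κ] (A : Matrix ι κ ℝ) : 0 ≤ opNorm A := by
  refine Real.sSup_nonneg ?_
  rintro _ ⟨x, -, rfl⟩
  exact evnorm_nonneg _

lemma evnorm_mulVec_le {ι κ : Type*} [Fintype ι] [Fintype κ] (A : Matrix ι κ ℝ) (x : κ → ℝ) :
    evnorm (A *ᵥ x) ≤ opNorm A * evnorm x := by
  classical
  have hbdd : BddAbove {r | ∃ x : κ → ℝ, evnorm x = 1 ∧ r = evnorm (A *ᵥ x)} := by
    refine ⟨‖Matrix.toEuclideanCLM (n := ι ⊕ κ) (𝕜 := ℝ) (Matrix.fromBlocks 0 A 0 0)‖, ?_⟩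
    rintro _ ⟨x, hx, rfl⟩
    have h := (Matrix.toEuclideanCLM (n := ι ⊕ κ) (𝕜 := ℝ)
      (Matrix.fromBlocks 0 A 0 0)).le_opNorm (WithLp.toLp 2 (Sum.elim 0 x))
    rw [Matrix.toEuclideanCLM_toLp, ← evnorm_eq_norm, ← evnorm_eq_norm] at h
    simpa [Matrix.fromBlocks_mulVec, evnorm, Fintype.sum_sum_type, show √(∑ i, x i ^ 2) = 1 from hx]
      using h
  rcases (evnorm_nonneg x).eq_or_lt with h0 | hpos
  · have hx : x = 0 := evnorm_eq_zero.1 h0.symm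
    simp [hx, evnorm]
  · have h : evnorm (A *ᵥ ((evnorm x)⁻¹ • x)) ≤ opNorm A := by
      refine le_csSup hbdd ⟨_, ?_, rfl⟩
      rw [evnorm_smul, abs_of_pos (inv_pos.2 hpos), inv_mul_cancel₀ hpos.ne']
    rwa [Matrix.mulVec_smul, evnorm_smul, abs_of_pos (inv_pos.2 hpos), inv_mul_le_iff₀ hpos,
      mul_comm] at h

lemma opNorm_le {ι κ : Type*} [Fintype ι] [Fintype κ] {A : Matrix ι κ ℝ} {c : ℝ} (hc : 0 ≤ c)
    (h : ∀ x, evnorm (A *ᵥ x) ≤ c * evnorm x) : opNorm A ≤ c := by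
  refine Real.sSup_le ?_ hc
  rintro _ ⟨x, hx, rfl⟩
  simpa [hx] using h x

lemma sigmaMin_mul_evnorm_le {ι κ : Type*} [Fintype ι] [Fintype κ] (A : Matrix ι κ ℝ)
    (x : κ → ℝ) : sigmaMin A * evnorm x ≤ evnorm (A *ᵥ x) := by
  rcases (evnorm_nonneg x).eq_or_lt with h0 | hpos
  · rw [← h0, mul_zero]
    exact evnorm_nonneg _
  · have h : sigmaMin A ≤ evnorm (A *ᵥ ((evnorm x)⁻¹ • x)) := by
      refine csInf_le ⟨0, ?_⟩ ⟨_, ?_, rfl⟩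
      · rintro _ ⟨y, -, rfl⟩
        exact evnorm_nonneg _
      · rw [evnorm_smul, abs_of_pos (inv_pos.2 hpos), inv_mul_cancel₀ hpos.ne']
    rwa [Matrix.mulVec_smul, evnorm_smul, abs_of_pos (inv_pos.2 hpos), le_inv_mul_iff₀ hpos,
      mul_comm] at h

/-- The residual of the least squares solution is orthogonal to the column space. -/
lemma mulVec_dotProduct_residual {ι κ : Type*} [Fintype ι] [Fintype κ] [DecidableEq κ]
    {P : Matrix ι κ ℝ} {a : ℝ} (ha : 0 < a) (hP : ∀ x, a * evnorm x ≤ evnorm (P *ᵥ x))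
    (y : ι → ℝ) (x : κ → ℝ) :
    P *ᵥ x ⬝ᵥ (y - P *ᵥ (((Pᵀ * P)⁻¹ * Pᵀ) *ᵥ y)) = 0 := by
  have hdet : IsUnit (Pᵀ * P).det := by
    rw [isUnit_iff_ne_zero]
    intro h
    obtain ⟨v, hv, hPv⟩ := Matrix.exists_mulVec_eq_zero_iff.2 h
    refine hv (evnorm_eq_zero.1 ?_)
    have h0 : evnorm (P *ᵥ v) ^ 2 = 0 := by
      rw [evnorm_sq, Matrix.dotProduct_mulVec, Matrix.vecMul_mulVec, ← Matrix.dotProduct_mulVec,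
        hPv, dotProduct_zero]
    have h1 := hP v
    rw [pow_eq_zero_iff two_ne_zero] at h0
    have := evnorm_nonneg v
    nlinarith
  have h : Pᵀ *ᵥ (y - P *ᵥ (((Pᵀ * P)⁻¹ * Pᵀ) *ᵥ y)) = 0 := by
    rw [Matrix.mulVec_sub, Matrix.mulVec_mulVec, Matrix.mulVec_mulVec, ← Matrix.mul_assoc,
      Matrix.mul_nonsing_inv _ hdet, Matrix.one_mul, sub_self]
  rw [← Matrix.vecMul_transpose, ← Matrix.dotProduct_mulVec, h, dotProduct_zero]

/-- Wedin's perturbation bound, with the better conditioned matrix second. -/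
lemma evnorm_leastSquares_sub_le_of_le {ι κ : Type*} [Fintype ι] [Fintype κ] [DecidableEq κ]
    {P Q : Matrix ι κ ℝ} {a b e : ℝ} (ha : 0 < a) (hab : a ≤ b) (he : 0 ≤ e)
    (hP : ∀ x, a * evnorm x ≤ evnorm (P *ᵥ x)) (hQ : ∀ x, b * evnorm x ≤ evnorm (Q *ᵥ x))
    (hPQ : ∀ x, evnorm (Q *ᵥ x - P *ᵥ x) ≤ e * evnorm x) (y : ι → ℝ) :
    evnorm (((Qᵀ * Q)⁻¹ * Qᵀ) *ᵥ y - ((Pᵀ * P)⁻¹ * Pᵀ) *ᵥ y) ≤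
      √2 * e / (a * b) * evnorm y := by
  have hb : 0 < b := ha.trans_le hab
  have hu := mulVec_dotProduct_residual ha hP y
  have hv := mulVec_dotProduct_residual hb hQ y
  set u := ((Pᵀ * P)⁻¹ * Pᵀ) *ᵥ y
  set v := ((Qᵀ * Q)⁻¹ * Qᵀ) *ᵥ y
  set w := v - u with hw
  set r := y - P *ᵥ u with hr
  have hpyth : evnorm (P *ᵥ u) ^ 2 + evnorm r ^ 2 = evnorm y ^ 2 := by
    have hy : y = P *ᵥ u + r := by rw [hr]; abel
    have h := hu u
    rw [evnorm_sq, evnorm_sq, evnorm_sq]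
    conv_rhs => rw [hy]
    rw [add_dotProduct, dotProduct_add, dotProduct_add, dotProduct_comm r (P *ᵥ u), h]
    ring
  have hexp : evnorm (Q *ᵥ w) ^ 2 =
      (Q *ᵥ w - P *ᵥ w) ⬝ᵥ r + Q *ᵥ w ⬝ᵥ (P *ᵥ u - Q *ᵥ u) := by
    have h1 := hu w
    have h2 := hv w
    have h3 : evnorm (Q *ᵥ w) ^ 2 = Q *ᵥ w ⬝ᵥ (Q *ᵥ v - Q *ᵥ u) := by
      rw [evnorm_sq, ← Matrix.mulVec_sub]
    rw [h3, sub_dotProduct, h1, hr]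
    simp only [dotProduct_sub] at h2 ⊢
    linarith
  have hsum : evnorm (P *ᵥ u) + evnorm r ≤ √2 * evnorm y := by
    refine abs_le_of_sq_le_sq' ?_ (mul_nonneg (Real.sqrt_nonneg 2) (evnorm_nonneg y)) |>.2
    rw [mul_pow, Real.sq_sqrt zero_le_two]
    nlinarith [sq_nonneg (evnorm (P *ᵥ u) - evnorm r)]
  have hQw : a * evnorm (Q *ᵥ w) ≤ e * (evnorm (P *ᵥ u) + evnorm r) := by
    have h1 : (Q *ᵥ w - P *ᵥ w) ⬝ᵥ r ≤ e * evnorm w * evnorm r :=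
      (dotProduct_le_evnorm_mul_evnorm _ _).trans
        (mul_le_mul_of_nonneg_right (hPQ w) (evnorm_nonneg r))
    have h2 : Q *ᵥ w ⬝ᵥ (P *ᵥ u - Q *ᵥ u) ≤ evnorm (Q *ᵥ w) * (e * evnorm u) := by
      refine (dotProduct_le_evnorm_mul_evnorm _ _).trans
        (mul_le_mul_of_nonneg_left ?_ (evnorm_nonneg _))
      rw [evnorm_sub_rev]
      exact hPQ u
    have h3 : a * evnorm w ≤ evnorm (Q *ᵥ w) :=
      (mul_le_mul_of_nonneg_right hab (evnorm_nonneg w)).trans (hQ w)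
    rcases (evnorm_nonneg (Q *ᵥ w)).eq_or_lt with h0 | hpos
    · rw [← h0, mul_zero]
      exact mul_nonneg he (add_nonneg (evnorm_nonneg _) (evnorm_nonneg _))
    · refine le_of_mul_le_mul_left ?_ hpos
      calc evnorm (Q *ᵥ w) * (a * evnorm (Q *ᵥ w)) = a * evnorm (Q *ᵥ w) ^ 2 := by ring
        _ ≤ a * (e * evnorm w * evnorm r + evnorm (Q *ᵥ w) * (e * evnorm u)) := by
          rw [hexp]
          exact mul_le_mul_of_nonneg_left (add_le_add h1 h2) ha.le
        _ = e * evnorm r * (a * evnorm w) + evnorm (Q *ᵥ w) * e * (a * evnorm u) := by ring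
        _ ≤ e * evnorm r * evnorm (Q *ᵥ w) + evnorm (Q *ᵥ w) * e * evnorm (P *ᵥ u) :=
          add_le_add (mul_le_mul_of_nonneg_left h3 (mul_nonneg he (evnorm_nonneg r)))
            (mul_le_mul_of_nonneg_left (hP u) (mul_nonneg hpos.le he))
        _ = evnorm (Q *ᵥ w) * (e * (evnorm (P *ᵥ u) + evnorm r)) := by ring
  rw [div_mul_eq_mul_div, le_div_iff₀ (mul_pos ha hb)]
  calc evnorm w * (a * b) = a * (b * evnorm w) := by ring
    _ ≤ a * evnorm (Q *ᵥ w) := mul_le_mul_of_nonneg_left (hQ w) ha.le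
    _ ≤ e * (evnorm (P *ᵥ u) + evnorm r) := hQw
    _ ≤ e * (√2 * evnorm y) := mul_le_mul_of_nonneg_left hsum he
    _ = √2 * e * evnorm y := by ring

/-- Wedin's perturbation bound for least squares solutions with full column rank. -/
lemma evnorm_leastSquares_sub_le {ι κ : Type*} [Fintype ι] [Fintype κ] [DecidableEq κ]
    {P Q : Matrix ι κ ℝ} {a b e : ℝ} (ha : 0 < a) (hb : 0 < b) (he : 0 ≤ e)
    (hP : ∀ x, a * evnorm x ≤ evnorm (P *ᵥ x)) (hQ : ∀ x, b * evnorm x ≤ evnorm (Q *ᵥ x))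
    (hPQ : ∀ x, evnorm (Q *ᵥ x - P *ᵥ x) ≤ e * evnorm x) (y : ι → ℝ) :
    evnorm (((Pᵀ * P)⁻¹ * Pᵀ) *ᵥ y - ((Qᵀ * Q)⁻¹ * Qᵀ) *ᵥ y) ≤
      √2 * e / (a * b) * evnorm y := by
  rcases le_total a b with hab | hba
  · rw [evnorm_sub_rev]
    exact evnorm_leastSquares_sub_le_of_le ha hab he hP hQ hPQ y
  · rw [mul_comm a b]
    refine evnorm_leastSquares_sub_le_of_le hb hba he hQ hP (fun x => ?_) y
    rw [evnorm_sub_rev]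
    exact hPQ x

/-- Perturbation of the Tikhonov-regularized pseudoinverse
(Lemma: perturbed-tikhonov-pseudoinverse). -/
theorem perturbed_tikhonov_pseudoinverse
    (m n : ℕ)
    (A D : Matrix (Fin m) (Fin n) ℝ)
    (σ : ℝ) (hσ : σ = sigmaMin A) (hσpos : 0 < σ)
    (δ : ℝ) (hδ : δ = opNorm D)
    (lam : ℝ) (hlam : 0 < lam)
    (B Bhat S : Matrix (Fin n) (Fin n ⊕ Fin m) ℝ)
    (hB : B = (Aᵀ * A)⁻¹ * (Matrix.fromRows (0 : Matrix (Fin n) (Fin n) ℝ) A)ᵀ)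
    (hBhat : Bhat = (lam ^ 2 • (1 : Matrix (Fin n) (Fin n) ℝ) + (A + D)ᵀ * (A + D))⁻¹
        * (Matrix.fromRows (lam • (1 : Matrix (Fin n) (Fin n) ℝ)) (A + D))ᵀ)
    (hS : S = B - Bhat) :
    opNorm S ≤ 2 * (lam + δ) / (σ * (lam + max 0 (σ - δ))) := by
  set τ := max 0 (σ - δ) with hτ
  have hτ0 : 0 ≤ τ := le_max_left _ _
  have hδ0 : 0 ≤ δ := hδ ▸ opNorm_nonneg D
  have hA : ∀ x, σ * evnorm x ≤ evnorm (A *ᵥ x) := fun x => hσ ▸ sigmaMin_mul_evnorm_le A x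
  have hD : ∀ x, evnorm (D *ᵥ x) ≤ δ * evnorm x := fun x => hδ ▸ evnorm_mulVec_le D x
  have hAD : ∀ x, τ * evnorm x ≤ evnorm ((A + D) *ᵥ x) := by
    intro x
    rcases max_cases 0 (σ - δ) with ⟨h, -⟩ | ⟨h, -⟩
    · rw [hτ, h, zero_mul]
      exact evnorm_nonneg _
    · rw [hτ, h, Matrix.add_mulVec]
      linarith [evnorm_sub_le_evnorm_add (A *ᵥ x) (D *ᵥ x), hA x, hD x]
  set P : Matrix (Fin n ⊕ Fin m) (Fin n) ℝ :=
    Matrix.fromRows (0 : Matrix (Fin n) (Fin n) ℝ) A with hPdef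
  set Q : Matrix (Fin n ⊕ Fin m) (Fin n) ℝ :=
    Matrix.fromRows (lam • (1 : Matrix (Fin n) (Fin n) ℝ)) (A + D) with hQdef
  have hPP : Pᵀ * P = Aᵀ * A := by
    simp [hPdef, Matrix.transpose_fromRows, Matrix.fromCols_mul_fromRows]
  have hQQ : Qᵀ * Q = lam ^ 2 • (1 : Matrix (Fin n) (Fin n) ℝ) + (A + D)ᵀ * (A + D) := by
    rw [hQdef, Matrix.transpose_fromRows, Matrix.fromCols_mul_fromRows]
    simp [smul_smul, sq]
  have hQP : Q - P = Matrix.fromRows (lam • (1 : Matrix (Fin n) (Fin n) ℝ)) D := by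
    ext (i | i) j <;> simp [hPdef, hQdef]
  have hlam_sq : ∀ x : Fin n → ℝ,
      evnorm ((lam • (1 : Matrix (Fin n) (Fin n) ℝ)) *ᵥ x) ^ 2 = (lam * evnorm x) ^ 2 := by
    intro x
    rw [Matrix.smul_mulVec, Matrix.one_mulVec, evnorm_smul, abs_of_pos hlam]
  set s := √(lam ^ 2 + τ ^ 2) with hs
  have hs_sq : s ^ 2 = lam ^ 2 + τ ^ 2 := Real.sq_sqrt (by positivity)
  have hs_pos : 0 < s := Real.sqrt_pos.2 (by positivity)
  have hP : ∀ x, σ * evnorm x ≤ evnorm (P *ᵥ x) := by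
    intro x
    refine abs_le_of_sq_le_sq' ?_ (evnorm_nonneg _) |>.2
    rw [hPdef, evnorm_mulVec_fromRows_sq]
    have := pow_le_pow_left₀ (mul_nonneg hσpos.le (evnorm_nonneg x)) (hA x) 2
    linarith [sq_nonneg (evnorm ((0 : Matrix (Fin n) (Fin n) ℝ) *ᵥ x))]
  have hQ : ∀ x, s * evnorm x ≤ evnorm (Q *ᵥ x) := by
    intro x
    refine abs_le_of_sq_le_sq' ?_ (evnorm_nonneg _) |>.2
    rw [hQdef, evnorm_mulVec_fromRows_sq, hlam_sq, mul_pow, hs_sq]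
    have := pow_le_pow_left₀ (mul_nonneg hτ0 (evnorm_nonneg x)) (hAD x) 2
    linarith
  have hPQ : ∀ x, evnorm (Q *ᵥ x - P *ᵥ x) ≤ (lam + δ) * evnorm x := by
    intro x
    refine abs_le_of_sq_le_sq' ?_ (mul_nonneg (by positivity) (evnorm_nonneg _)) |>.2
    rw [← Matrix.sub_mulVec, hQP, evnorm_mulVec_fromRows_sq, hlam_sq]
    have := pow_le_pow_left₀ (evnorm_nonneg _) (hD x) 2
    have : 0 ≤ lam * δ * evnorm x ^ 2 := by positivity
    linarith
  have hs_le : lam + τ ≤ √2 * s := by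
    refine abs_le_of_sq_le_sq' ?_ (by positivity) |>.2
    rw [mul_pow, Real.sq_sqrt zero_le_two, hs_sq]
    linarith [sq_nonneg (lam - τ)]
  have hconst : √2 * (lam + δ) / (σ * s) ≤ 2 * (lam + δ) / (σ * (lam + τ)) := by
    rw [div_le_div_iff₀ (by positivity) (by positivity)]
    calc √2 * (lam + δ) * (σ * (lam + τ)) ≤ √2 * (lam + δ) * (σ * (√2 * s)) := by gcongr
      _ = (√2 * √2) * (lam + δ) * (σ * s) := by ring
      _ = 2 * (lam + δ) * (σ * s) := by rw [Real.mul_self_sqrt zero_le_two]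
  refine (opNorm_le (by positivity) fun y => ?_).trans hconst
  rw [hS, hB, hBhat, ← hPP, ← hQQ, Matrix.sub_mulVec]
  exact evnorm_leastSquares_sub_le hσpos hs_pos (by positivity) hP hQ hPQ y
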